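/- Let n ≥ 2, and let σ be any permutation of {1, …, n−1}. Define the modified linear entanglement layer E_σ := M_{σ(1)} · M_{σ(2)} · ⋯ · M_{σ(n−1)}, where M_j := I_{2^{n−1−j}} ⊗ₖ CX ⊗ₖ I_{2^{j−1}} is the CX gate with control qubit j and target qubit j−1, and define the layer Lay_σ(θ) := E_σ · (RX(θ_{n−1}) ⊗ₖ ⋯ ⊗ₖ RX(θ_0)) and the L-layer ansatz U_σ(Θ) := Lay_σ(Θ_{L−1}) · ⋯ · Lay_σ(Θ_0) for Θ ∈ (ℝ^n)^L. Then for every Θ there exists Θ' ∈ (ℝ^n)^L with Θ'_{j,i} = 0 whenever j ≥ 2^{⌈log₂(i+1)⌉}, such that U_σ(Θ') = U_σ(Θ); that is, changing the order of the CX gates within the linear entanglement layer does not increase the number of effective parameters on each qubit. -/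

import Mathlib

open Matrix

noncomputable section

/-- The single-qubit rotation gate `RX θ`. -/
def RXg (θ : ℝ) : Matrix (Fin 2) (Fin 2) ℂ :=
  !![(Real.cos (θ / 2) : ℂ), -Complex.I * (Real.sin (θ / 2) : ℂ);
     -Complex.I * (Real.sin (θ / 2) : ℂ), (Real.cos (θ / 2) : ℂ)]

/-- The embedded CX gate `I ⊗ₖ CX ⊗ₖ I` with control qubit `c` and target qubit `t`,
as a matrix on the basis states `Fin n → Fin 2` (qubit `0` being the last Kronecker factor). -/
def CXe {n : ℕ} (c t : Fin n) : Matrix (Fin n → Fin 2) (Fin n → Fin 2) ℂ :=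
  fun u v => if u = Function.update v t (v t + v c) then 1 else 0

/-- The Kronecker product `RX θ_{n-1} ⊗ₖ ⋯ ⊗ₖ RX θ_0`. -/
def RXall {n : ℕ} (θ : Fin n → ℝ) : Matrix (Fin n → Fin 2) (Fin n → Fin 2) ℂ :=
  fun u v => ∏ i, RXg (θ i) (u i) (v i)

/-- The linear entanglement layer `M_1 · M_2 · ⋯ · M_{n-1}`,
where `M_j` is the CX gate with control qubit `j` and target qubit `j-1`. -/
def Elin (n : ℕ) : Matrix (Fin n → Fin 2) (Fin n → Fin 2) ℂ :=
  ((List.finRange (n - 1)).map (fun j =>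
    CXe (n := n) ⟨j.val + 1, by have := j.isLt; omega⟩ ⟨j.val, by have := j.isLt; omega⟩)).prod

/-- The single-layer `n`-qubit RX-CX unitary with linear entanglement. -/
def LayU (n : ℕ) (θ : Fin n → ℝ) : Matrix (Fin n → Fin 2) (Fin n → Fin 2) ℂ :=
  Elin n * RXall θ

/-- The modified linear entanglement layer `E_σ = M_{σ(1)} · M_{σ(2)} · ⋯ · M_{σ(n-1)}`,
where `M_j` is the CX gate with control qubit `j` and target qubit `j-1` and `σ` is a
permutation of `{1, …, n-1}` (encoded as a permutation of `Fin (n-1)` via `s ↦ s+1`). -/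
def Eperm (n : ℕ) (σ : Equiv.Perm (Fin (n - 1))) : Matrix (Fin n → Fin 2) (Fin n → Fin 2) ℂ :=
  ((List.finRange (n - 1)).map (fun s =>
    CXe (n := n) ⟨(σ s).val + 1, by have := (σ s).isLt; omega⟩
      ⟨(σ s).val, by have := (σ s).isLt; omega⟩)).prod

/-- One layer `Lay_σ(θ) = E_σ · (RX(θ_{n-1}) ⊗ₖ ⋯ ⊗ₖ RX(θ_0))` of the modified ansatz. -/
def LayPerm (n : ℕ) (σ : Equiv.Perm (Fin (n - 1))) (θ : Fin n → ℝ) :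
    Matrix (Fin n → Fin 2) (Fin n → Fin 2) ℂ :=
  Eperm n σ * RXall θ

/-- The `L`-layer ansatz `U_σ(Θ) = Lay_σ(Θ_{L-1}) · ⋯ · Lay_σ(Θ_0)`. -/
def ansatzPerm (n L : ℕ) (σ : Equiv.Perm (Fin (n - 1))) (Θ : Fin L → Fin n → ℝ) :
    Matrix (Fin n → Fin 2) (Fin n → Fin 2) ℂ :=
  ((List.finRange L).reverse.map (fun t => LayPerm n σ (Θ t))).prod

/-- The permutation-type matrix sending the basis state `v` to `e v`. -/
def basisMap (n : ℕ) :
    AddMonoid.End (Fin n → Fin 2) →* Matrix (Fin n → Fin 2) (Fin n → Fin 2) ℂ where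
  toFun e := Matrix.of fun u v => if u = e v then 1 else 0
  map_one' := by
    ext u v
    simp only [Matrix.one_apply, Matrix.of_apply, AddMonoid.End.coe_one, id_eq]
    congr
  map_mul' e f := by
    ext u v
    simp only [Matrix.mul_apply, Matrix.of_apply, AddMonoid.End.coe_mul, Function.comp_apply,
      mul_ite, mul_one, mul_zero, Finset.sum_ite_eq', Finset.mem_univ, if_true]
    congr

theorem basisMap_apply {n : ℕ} (e : AddMonoid.End (Fin n → Fin 2)) (u v : Fin n → Fin 2) :
    basisMap n e u v = if u = e v then 1 else 0 := rfl

/-- The matrix of bit flips along `a`, sending the basis state `v` to `v + a`. -/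
def bitFlip (n : ℕ) :
    Multiplicative (Fin n → Fin 2) →* Matrix (Fin n → Fin 2) (Fin n → Fin 2) ℂ where
  toFun a := Matrix.of fun u v => if u = v + a.toAdd then 1 else 0
  map_one' := by
    ext u v
    simp [Matrix.one_apply]
  map_mul' a b := by
    ext u v
    simp [Matrix.mul_apply, add_assoc, add_comm a.toAdd]

theorem bitFlip_ofAdd_apply {n : ℕ} (a u v : Fin n → Fin 2) :
    bitFlip n (Multiplicative.ofAdd a) u v = if u = v + a then 1 else 0 := rfl

/-- The representation of the group algebra of `Fin n → Fin 2` by combinations of bit flips. -/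
def flipAlg (n : ℕ) :
    AddMonoidAlgebra ℂ (Fin n → Fin 2) →ₐ[ℂ] Matrix (Fin n → Fin 2) (Fin n → Fin 2) ℂ :=
  AddMonoidAlgebra.lift ℂ _ _ (bitFlip n)

/-- The element of the group algebra representing the rotation by `θ` generated by the flip
along `a`. -/
def flipRot {n : ℕ} (a : Fin n → Fin 2) (θ : ℝ) : AddMonoidAlgebra ℂ (Fin n → Fin 2) :=
  AddMonoidAlgebra.single 0 (Real.cos (θ / 2) : ℂ) +
    AddMonoidAlgebra.single a (-Complex.I * (Real.sin (θ / 2) : ℂ))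

theorem bits_add_self {n : ℕ} (v : Fin n → Fin 2) : v + v = 0 := by
  ext i : 1
  exact (by decide : ∀ x : Fin 2, x + x = 0) (v i)

theorem flipRot_zero {n : ℕ} (a : Fin n → Fin 2) : flipRot a 0 = 1 := by
  simp [flipRot, AddMonoidAlgebra.one_def]

theorem flipRot_add {n : ℕ} (a : Fin n → Fin 2) (θ η : ℝ) :
    flipRot a (θ + η) = flipRot a θ * flipRot a η := by
  simp only [flipRot, mul_add, add_mul, AddMonoidAlgebra.single_mul_single, bits_add_self,
    add_zero, zero_add, add_div, Real.cos_add, Real.sin_add]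
  have h : ∀ x y z w : AddMonoidAlgebra ℂ (Fin n → Fin 2),
      x + y + (z + w) = (x + w) + (y + z) := fun x y z w => by ring
  rw [h, ← AddMonoidAlgebra.single_add, ← AddMonoidAlgebra.single_add]
  congr 2
  · push_cast
    linear_combination
      -Complex.sin (θ / 2) * Complex.sin (η / 2) * Complex.I_mul_I
  · push_cast
    ring

theorem flipRot_sum {n : ℕ} {ι : Type*} (a : Fin n → Fin 2) (s : Finset ι) (t : ι → ℝ) :
    flipRot a (∑ k ∈ s, t k) = ∏ k ∈ s, flipRot a (t k) := by
  classical
  induction s using Finset.induction_on with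
  | empty => simp [flipRot_zero]
  | insert k s hk ih => rw [Finset.sum_insert hk, Finset.prod_insert hk, flipRot_add, ih]

theorem flipAlg_flipRot {n : ℕ} (a : Fin n → Fin 2) (θ : ℝ) :
    flipAlg n (flipRot a θ) = (Real.cos (θ / 2) : ℂ) • 1 +
      (-Complex.I * (Real.sin (θ / 2) : ℂ)) • bitFlip n (Multiplicative.ofAdd a) := by
  simp only [flipAlg, flipRot, map_add, AddMonoidAlgebra.lift_single, ofAdd_zero, map_one]

theorem semiconjBy_basisMap_bitFlip {n : ℕ} (e : AddMonoid.End (Fin n → Fin 2))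
    (a : Fin n → Fin 2) :
    SemiconjBy (basisMap n e) (bitFlip n (Multiplicative.ofAdd a))
      (bitFlip n (Multiplicative.ofAdd (e a))) := by
  ext u v
  simp [basisMap_apply, bitFlip_ofAdd_apply, Matrix.mul_apply]

theorem semiconjBy_basisMap_flipRot {n : ℕ} (e : AddMonoid.End (Fin n → Fin 2))
    (a : Fin n → Fin 2) (θ : ℝ) :
    SemiconjBy (basisMap n e) (flipAlg n (flipRot a θ)) (flipAlg n (flipRot (e a) θ)) := by
  rw [flipAlg_flipRot, flipAlg_flipRot]
  refine SemiconjBy.add_right ?_ ?_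
  · exact (SemiconjBy.one_right _).smul_right _
  · exact (semiconjBy_basisMap_bitFlip e a).smul_right _

theorem semiconjBy_basisMap_prod {n : ℕ} {ι : Type*} (e : AddMonoid.End (Fin n → Fin 2))
    (s : Finset ι) (a : ι → Fin n → Fin 2) (t : ι → ℝ) :
    SemiconjBy (basisMap n e) (flipAlg n (∏ k ∈ s, flipRot (a k) (t k)))
      (flipAlg n (∏ k ∈ s, flipRot (e (a k)) (t k))) := by
  classical
  induction s using Finset.induction_on with
  | empty => simp
  | insert k s hk ih =>
    rw [Finset.prod_insert hk, Finset.prod_insert hk, map_mul, map_mul]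
    exact (semiconjBy_basisMap_flipRot e (a k) (t k)).mul_right ih

theorem RXg_zero : RXg 0 = 1 := by
  ext i j
  fin_cases i <;> fin_cases j <;> simp [RXg]

theorem RXg_apply (θ : ℝ) (x y : Fin 2) :
    RXg θ x y = (Real.cos (θ / 2) : ℂ) * RXg 0 x y +
      (-Complex.I * (Real.sin (θ / 2) : ℂ)) * RXg 0 (x + 1) y := by
  rw [RXg_zero]
  revert x y
  simp [Fin.forall_fin_two, RXg, Matrix.one_apply]

theorem RXall_zero {n : ℕ} : RXall (0 : Fin n → ℝ) = 1 := by
  ext u v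
  simp only [RXall, Pi.zero_apply, RXg_zero, Matrix.one_apply]
  rw [Finset.prod_ite_zero]
  simp [funext_iff]

theorem RXall_update {n : ℕ} (θ : Fin n → ℝ) (i : Fin n) (t : ℝ) (hi : θ i = 0) :
    RXall (Function.update θ i t) = flipAlg n (flipRot (Pi.single i 1) t) * RXall θ := by
  ext u v
  have hflip : (bitFlip n (Multiplicative.ofAdd (Pi.single i 1)) * RXall θ) u v =
      RXall θ (u + Pi.single i 1) v := by
    rw [Matrix.mul_apply, Finset.sum_eq_single (u + Pi.single i 1)]
    · simp [bitFlip_ofAdd_apply, add_assoc, bits_add_self]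
    · intro w _ hw
      have : u ≠ w + Pi.single i 1 := by
        rintro rfl
        exact hw (by simp [add_assoc, bits_add_self])
      simp [bitFlip_ofAdd_apply, this]
    · simp
  rw [flipAlg_flipRot, add_mul, smul_mul_assoc, smul_mul_assoc, one_mul, Matrix.add_apply,
    Matrix.smul_apply, Matrix.smul_apply, hflip]
  have hsplit : ∀ (η : Fin n → ℝ) (w : Fin n → Fin 2), RXall η w v =
      RXg (η i) (w i) (v i) * ∏ k ∈ Finset.univ.erase i, RXg (η k) (w k) (v k) :=
    fun _ _ => (Finset.mul_prod_erase _ _ (Finset.mem_univ i)).symm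
  rw [hsplit, hsplit θ u, hsplit θ (u + Pi.single i 1), smul_eq_mul, smul_eq_mul]
  have h1 : ∏ k ∈ Finset.univ.erase i, RXg (Function.update θ i t k) (u k) (v k) =
      ∏ k ∈ Finset.univ.erase i, RXg (θ k) (u k) (v k) :=
    Finset.prod_congr rfl fun k hk => by
      rw [Function.update_of_ne (Finset.ne_of_mem_erase hk)]
  have h2 : ∏ k ∈ Finset.univ.erase i, RXg (θ k) ((u + Pi.single i 1 : Fin n → Fin 2) k) (v k) =
      ∏ k ∈ Finset.univ.erase i, RXg (θ k) (u k) (v k) :=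
    Finset.prod_congr rfl fun k hk => by
      rw [Pi.add_apply, Pi.single_eq_of_ne (Finset.ne_of_mem_erase hk), add_zero]
  rw [h1, h2, Function.update_self, hi, RXg_apply t, Pi.add_apply, Pi.single_eq_same]
  ring

theorem RXall_eq_flipAlg {n : ℕ} (θ : Fin n → ℝ) :
    RXall θ = flipAlg n (∏ i, flipRot (Pi.single i 1) (θ i)) := by
  suffices h : ∀ s : Finset (Fin n), RXall (fun i => if i ∈ s then θ i else 0) =
      flipAlg n (∏ i ∈ s, flipRot (Pi.single i 1) (θ i)) by
    simpa using h Finset.univ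
  intro s
  induction s using Finset.induction_on with
  | empty => exact RXall_zero.trans (by simp)
  | insert i s hi ih =>
    rw [Finset.prod_insert hi, map_mul, ← ih, ← RXall_update _ _ _ (if_neg hi)]
    congr 1
    ext k
    by_cases hk : k = i
    · simp [hk]
    · simp [hk]

/-- The additive map on basis states underlying a `CX` gate. -/
def cxEnd {n : ℕ} (c t : Fin n) : AddMonoid.End (Fin n → Fin 2) where
  toFun v := Function.update v t (v t + v c)
  map_zero' := by simp
  map_add' v w := by
    ext k : 1
    by_cases hk : k = t
    · subst hk
      simp [add_add_add_comm]
    · simp [hk]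

theorem CXe_eq_basisMap {n : ℕ} (c t : Fin n) : CXe c t = basisMap n (cxEnd c t) := rfl

/-- An additive map `e` is unipotent for the flag of states supported on the lowest qubits:
if `v` vanishes above qubit `m`, then `e v` agrees with `v` from qubit `m` on. -/
def IsFlagUnipotent {n : ℕ} (e : AddMonoid.End (Fin n → Fin 2)) : Prop :=
  ∀ (m : ℕ) (v : Fin n → Fin 2), (∀ i : Fin n, m + 1 ≤ i.val → v i = 0) →
    ∀ i : Fin n, m ≤ i.val → e v i = v i

theorem IsFlagUnipotent.one {n : ℕ} :
    IsFlagUnipotent (1 : AddMonoid.End (Fin n → Fin 2)) := fun _ _ _ _ _ => rfl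

theorem IsFlagUnipotent.mul {n : ℕ} {e f : AddMonoid.End (Fin n → Fin 2)}
    (he : IsFlagUnipotent e) (hf : IsFlagUnipotent f) : IsFlagUnipotent (e * f) := by
  intro m v hv i hi
  rw [AddMonoid.End.coe_mul, Function.comp_apply, he m (f v) _ i hi, hf m v hv i hi]
  intro k hk
  rw [hf m v hv k (by omega), hv k hk]

theorem IsFlagUnipotent.list_prod {n : ℕ} {l : List (AddMonoid.End (Fin n → Fin 2))}
    (hl : ∀ e ∈ l, IsFlagUnipotent e) : IsFlagUnipotent l.prod :=
  List.prod_induction _ (fun _ _ => IsFlagUnipotent.mul) IsFlagUnipotent.one hl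

theorem isFlagUnipotent_cxEnd {n : ℕ} {c t : Fin n} (h : t < c) :
    IsFlagUnipotent (cxEnd c t) := by
  intro m v hv i hi
  change Function.update v t (v t + v c) i = v i
  by_cases hit : i = t
  · subst hit
    simp [hv c (by have : i.val < c.val := h; omega)]
  · simp [hit]

theorem exists_Eperm_eq_basisMap (n : ℕ) (σ : Equiv.Perm (Fin (n - 1))) :
    ∃ e, IsFlagUnipotent e ∧ Eperm n σ = basisMap n e := by
  refine ⟨((List.finRange (n - 1)).map (fun s =>
    cxEnd (n := n) ⟨(σ s).val + 1, by have := (σ s).isLt; omega⟩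
      ⟨(σ s).val, by have := (σ s).isLt; omega⟩)).prod, ?_, ?_⟩
  · refine IsFlagUnipotent.list_prod fun e he => ?_
    obtain ⟨s, -, rfl⟩ := List.mem_map.mp he
    exact isFlagUnipotent_cxEnd (by simp [Fin.lt_def])
  · rw [map_list_prod, List.map_map]
    rfl

theorem end_add_self {n : ℕ} (e : AddMonoid.End (Fin n → Fin 2)) : e + e = 0 := by
  ext v : 1
  exact bits_add_self (e v)

theorem one_add_pow_two_pow {n : ℕ} (e : AddMonoid.End (Fin n → Fin 2)) (k : ℕ) :
    (1 + e) ^ 2 ^ k = 1 + e ^ 2 ^ k := by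
  induction k with
  | zero => simp
  | succ k ih =>
    rw [pow_succ 2 k, pow_mul, pow_mul, ih, sq, sq, mul_add, add_mul, add_mul,
      one_mul, one_mul, mul_one, add_assoc, ← add_assoc (e ^ 2 ^ k), end_add_self, zero_add]

theorem IsFlagUnipotent.one_add_pow_apply {n : ℕ} {e : AddMonoid.End (Fin n → Fin 2)}
    (he : IsFlagUnipotent e) {m : ℕ} {v : Fin n → Fin 2}
    (hv : ∀ i : Fin n, m ≤ i.val → v i = 0) (k : ℕ) :
    ∀ i : Fin n, m ≤ i.val + k → ((1 + e) ^ k) v i = 0 := by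
  induction k with
  | zero => simpa using hv
  | succ k ih =>
    intro i hi
    rw [pow_succ', AddMonoid.End.coe_mul, Function.comp_apply]
    set w := ((1 + e) ^ k) v
    change w i + e w i = 0
    rw [he i.val w (fun j hj => ih j (by omega)) i le_rfl]
    exact congrFun (bits_add_self w) i

theorem IsFlagUnipotent.pow_two_pow_clog_apply_single {n : ℕ}
    {e : AddMonoid.End (Fin n → Fin 2)} (he : IsFlagUnipotent e) (i : Fin n) :
    (e ^ 2 ^ Nat.clog 2 (i.val + 1)) (Pi.single i 1) = Pi.single i 1 := by
  have h := one_add_pow_two_pow (1 + e) (Nat.clog 2 (i.val + 1))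
  rw [← add_assoc, end_add_self, zero_add] at h
  rw [h]
  change Pi.single i 1 +
    ((1 + e : AddMonoid.End (Fin n → Fin 2)) ^ 2 ^ Nat.clog 2 (i.val + 1)) (Pi.single i 1) = _
  rw [add_eq_left]
  ext k : 1
  refine he.one_add_pow_apply (m := i.val + 1) ?_ _ k ?_
  · intro j hj
    exact Pi.single_eq_of_ne (by rintro rfl; omega) _
  · have := Nat.le_pow_clog (b := 2) (by norm_num) (i.val + 1)
    omega

theorem ansatzPerm_eq {n : ℕ} {σ : Equiv.Perm (Fin (n - 1))}
    {e : AddMonoid.End (Fin n → Fin 2)} (he : Eperm n σ = basisMap n e) (L : ℕ)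
    (Θ : Fin L → Fin n → ℝ) :
    ansatzPerm n L σ Θ =
      flipAlg n (∏ j : Fin L, ∏ i, flipRot ((e ^ (L - j.val)) (Pi.single i 1)) (Θ j i)) *
        basisMap n e ^ L := by
  induction L with
  | zero => simp [ansatzPerm]
  | succ L ih =>
    have hrec : ansatzPerm n (L + 1) σ Θ =
        LayPerm n σ (Θ (Fin.last L)) * ansatzPerm n L σ (fun j => Θ j.castSucc) := by
      simp [ansatzPerm, List.finRange_succ_last, Function.comp_def]
    rw [hrec, ih, LayPerm, he, RXall_eq_flipAlg, pow_succ', mul_assoc, ← mul_assoc (flipAlg n _),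
      ← map_mul, ← mul_assoc, ← mul_assoc]
    congr 1
    have h1 := semiconjBy_basisMap_prod e Finset.univ (fun i : Fin n => Pi.single i 1)
      (Θ (Fin.last L))
    have h2 := semiconjBy_basisMap_prod e (Finset.univ : Finset (Fin L × Fin n))
      (fun p => (e ^ (L - p.1.val)) (Pi.single p.2 1)) (fun p => Θ p.1.castSucc p.2)
    rw [Fintype.prod_prod_type, Fintype.prod_prod_type] at h2
    rw [map_mul, (h1.mul_right h2).eq, ← map_mul, Fin.prod_univ_castSucc, mul_comm (∏ i, _)]
    have hpow : ∀ j : Fin L, e ^ (L + 1 - j.val) = e * e ^ (L - j.val) := fun j => by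
      rw [← pow_succ', Nat.sub_add_comm j.isLt.le]
    simp [hpow, AddMonoid.End.coe_mul, Function.comp_apply]

theorem stmt10 (n L : ℕ) (hn : 2 ≤ n) (σ : Equiv.Perm (Fin (n - 1)))
    (Θ : Fin L → Fin n → ℝ) :
    ∃ Θ' : Fin L → Fin n → ℝ,
      (∀ (j : Fin L) (i : Fin n), 2 ^ Nat.clog 2 (i.val + 1) ≤ j.val → Θ' j i = 0) ∧
      ansatzPerm n L σ Θ' = ansatzPerm n L σ Θ := by
  obtain ⟨e, hu, he⟩ := exists_Eperm_eq_basisMap n σ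
  let π : Fin n → Fin L → Fin L := fun i j =>
    ⟨j.val % 2 ^ Nat.clog 2 (i.val + 1), (Nat.mod_le _ _).trans_lt j.isLt⟩
  refine ⟨fun j i => ∑ k with π i k = j, Θ k i, fun j i hj => ?_, ?_⟩
  · refine Finset.sum_eq_zero fun k hk => absurd ?_ (not_lt.mpr hj)
    rw [← (Finset.mem_filter.mp hk).2]
    exact Nat.mod_lt _ (by positivity)
  · rw [ansatzPerm_eq he, ansatzPerm_eq he, Finset.prod_comm,
      Finset.prod_comm (s := (Finset.univ : Finset (Fin L)))]
    congr 2
    refine Finset.prod_congr rfl fun i _ => ?_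
    have hper : ∀ k : Fin L, (e ^ (L - (π i k).val)) (Pi.single i 1) =
        (e ^ (L - k.val)) (Pi.single i 1) := by
      intro k
      set M := 2 ^ Nat.clog 2 (i.val + 1) with hM
      have hfix : ∀ q : ℕ, ((e ^ M) ^ q) (Pi.single i 1) = Pi.single i 1 := by
        intro q
        induction q with
        | zero => rfl
        | succ q ih =>
          rw [pow_succ, AddMonoid.End.coe_mul, Function.comp_apply,
            hu.pow_two_pow_clog_apply_single, ih]
      have hexp : L - (π i k).val = (L - k.val) + M * (k.val / M) := by
        have h1 : (π i k).val = k.val % M := rfl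
        have h2 := Nat.mod_add_div k.val M
        have h3 := k.isLt
        omega
      rw [hexp, pow_add, pow_mul, AddMonoid.End.coe_mul, Function.comp_apply, hfix]
    simp only [flipRot_sum]
    rw [← Finset.prod_fiberwise Finset.univ (π i)
      (fun k => flipRot ((e ^ (L - k.val)) (Pi.single i 1)) (Θ k i))]
    refine Finset.prod_congr rfl fun j _ => Finset.prod_congr rfl fun k hk => ?_
    rw [← hper k, (Finset.mem_filter.mp hk).2]

end
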